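/- Let p be a prime, let K = SL₂(ℤ_p) be the subgroup of SL₂(ℚ_p) consisting of matrices with all entries in ℤ_p, let U (resp. U⁻) be the subgroup of upper (resp. lower) triangular unipotent matrices in SL₂(ℚ_p), and for n ∈ ℕ let d_n = diag(p^{−n}, p^n) ∈ SL₂(ℚ_p). Then the image of the set K·U⁻ ∩ K·d_n·U under the quotient map SL₂(ℚ_p) → K\SL₂(ℚ_p) (taking g to its left coset K·g) is a finite set, of cardinality p^n − p^{n−1} if n ≥ 1, and of cardinality 1 if n = 0. (This is the rank-one computation of the coefficients of the Gindikin–Karpelevich sum c_𝔤 in formula (1.1), to which the paper reduces the proof of the finite Gindikin–Karpelevich formula, Theorem 1.1.) -/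

import Mathlib

open Matrix
open scoped Pointwise

/-- The subgroup (here: subset) `K = SL₂(ℤ_p)` of `SL₂(ℚ_p)` consisting of the
matrices all of whose entries are `p`-adic integers. -/
def sl2KSet (p : ℕ) [Fact p.Prime] : Set (Matrix.SpecialLinearGroup (Fin 2) ℚ_[p]) :=
  {g | ∀ i j : Fin 2, ‖(g : Matrix (Fin 2) (Fin 2) ℚ_[p]) i j‖ ≤ 1}

/-- The subgroup (here: subset) `U` of upper triangular unipotent matrices in `SL₂(ℚ_p)`. -/
def sl2USet (p : ℕ) [Fact p.Prime] : Set (Matrix.SpecialLinearGroup (Fin 2) ℚ_[p]) :=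
  {g | (g : Matrix (Fin 2) (Fin 2) ℚ_[p]) 0 0 = 1 ∧
       (g : Matrix (Fin 2) (Fin 2) ℚ_[p]) 1 1 = 1 ∧
       (g : Matrix (Fin 2) (Fin 2) ℚ_[p]) 1 0 = 0}

/-- The subgroup (here: subset) `U⁻` of lower triangular unipotent matrices in `SL₂(ℚ_p)`. -/
def sl2UminusSet (p : ℕ) [Fact p.Prime] : Set (Matrix.SpecialLinearGroup (Fin 2) ℚ_[p]) :=
  {g | (g : Matrix (Fin 2) (Fin 2) ℚ_[p]) 0 0 = 1 ∧
       (g : Matrix (Fin 2) (Fin 2) ℚ_[p]) 1 1 = 1 ∧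
       (g : Matrix (Fin 2) (Fin 2) ℚ_[p]) 0 1 = 0}

/-- The diagonal element `d_n = diag(p^{-n}, p^n)` of `SL₂(ℚ_p)`. -/
noncomputable def sl2DiagElt (p : ℕ) [Fact p.Prime] (n : ℕ) : Matrix.SpecialLinearGroup (Fin 2) ℚ_[p] :=
  ⟨!![(p : ℚ_[p]) ^ (-(n : ℤ)), 0; 0, (p : ℚ_[p]) ^ (n : ℤ)], by
    have hp : (p : ℚ_[p]) ≠ 0 :=
      Nat.cast_ne_zero.mpr (Fact.out : p.Prime).ne_zero
    rw [Matrix.det_fin_two_of]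
    rw [mul_zero, sub_zero, ← zpow_add₀ hp]
    simp⟩

namespace SL2Padic

variable {p : ℕ} [Fact p.Prime]

open scoped MatrixGroups

/-- The subgroup `SL₂(ℤ_p)` of `SL₂(ℚ_p)`. -/
noncomputable def integralSubgroup (p : ℕ) [Fact p.Prime] :
    Subgroup SL(2, ℚ_[p]) :=
  (Matrix.SpecialLinearGroup.map (n := Fin 2) (algebraMap ℤ_[p] ℚ_[p])).range

theorem coe_integralSubgroup : (integralSubgroup p : Set SL(2, ℚ_[p])) = sl2KSet p := by
  ext g
  constructor
  · rintro ⟨k, rfl⟩ i j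
    exact (k i j).2
  · intro hg
    refine ⟨⟨Matrix.of fun i j => ⟨g i j, hg i j⟩, ?_⟩, ?_⟩
    · have h := g.det_coe
      rw [Matrix.det_fin_two] at h ⊢
      exact Subtype.ext h
    · ext i j
      rfl

theorem mem_integralSubgroup {g : SL(2, ℚ_[p])} :
    g ∈ integralSubgroup p ↔ ∀ i j, ‖(g : Matrix (Fin 2) (Fin 2) ℚ_[p]) i j‖ ≤ 1 := by
  rw [← SetLike.mem_coe, coe_integralSubgroup]
  rfl

theorem mul_singleton_eq_iff (g h : SL(2, ℚ_[p])) :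
    sl2KSet p * {g} = sl2KSet p * {h} ↔ h * g⁻¹ ∈ integralSubgroup p := by
  rw [← coe_integralSubgroup, ← rightCoset_eq_iff]
  simp only [Set.mul_singleton]
  rfl

/-- The lower triangular unipotent matrix with lower left entry `x`. -/
noncomputable def lower (x : ℚ_[p]) : SL(2, ℚ_[p]) := ⟨!![1, 0; x, 1], by simp⟩

theorem coe_lower (x : ℚ_[p]) : (lower x : Matrix (Fin 2) (Fin 2) ℚ_[p]) = !![1, 0; x, 1] := rfl

theorem lower_mul_lower_inv (x y : ℚ_[p]) : lower y * (lower x)⁻¹ = lower (y - x) := by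
  rw [mul_inv_eq_iff_eq_mul]
  ext i j
  fin_cases i <;> fin_cases j <;> simp [coe_lower]

theorem lower_mem_integralSubgroup {x : ℚ_[p]} :
    lower x ∈ integralSubgroup p ↔ ‖x‖ ≤ 1 := by
  rw [mem_integralSubgroup]
  simp [Fin.forall_fin_two, coe_lower]

theorem mem_sl2UminusSet {g : SL(2, ℚ_[p])} : g ∈ sl2UminusSet p ↔ ∃ x, g = lower x := by
  constructor
  · rintro ⟨h₀, h₁, h₂⟩
    refine ⟨g 1 0, ?_⟩
    ext i j
    fin_cases i <;> fin_cases j <;> simp [coe_lower, h₀, h₁, h₂]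
  · rintro ⟨x, rfl⟩
    exact ⟨rfl, rfl, rfl⟩

theorem max_norm_first_column_eq_one {k : SL(2, ℚ_[p])} (hk : k ∈ integralSubgroup p) :
    max ‖k 0 0‖ ‖k 1 0‖ = 1 := by
  rw [mem_integralSubgroup] at hk
  refine le_antisymm (max_le (hk _ _) (hk _ _)) ?_
  have hdet := k.det_coe
  rw [Matrix.det_fin_two] at hdet
  calc (1 : ℝ) = ‖k 0 0 * k 1 1 - k 0 1 * k 1 0‖ := by rw [hdet, norm_one]
    _ ≤ max ‖k 0 0 * k 1 1‖ ‖k 0 1 * k 1 0‖ := by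
      simpa [sub_eq_add_neg] using Padic.nonarchimedean (k 0 0 * k 1 1) (-(k 0 1 * k 1 0))
    _ ≤ max ‖k 0 0‖ ‖k 1 0‖ := by
      rw [norm_mul, norm_mul]
      exact max_le_max (mul_le_of_le_one_right (norm_nonneg _) (hk _ _))
        (mul_le_of_le_one_left (norm_nonneg _) (hk _ _))

theorem exists_integral_first_column {a c : ℚ_[p]} (h : max ‖a‖ ‖c‖ = 1) :
    ∃ k ∈ integralSubgroup p, k 0 0 = a ∧ k 1 0 = c := by
  have ha : ‖a‖ ≤ 1 := h ▸ le_max_left _ _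
  have hc : ‖c‖ ≤ 1 := h ▸ le_max_right _ _
  rcases max_choice ‖a‖ ‖c‖ with h' | h' <;> rw [h'] at h
  · have h0 : a ≠ 0 := norm_ne_zero_iff.mp (by simp [h])
    refine ⟨⟨!![a, 0; c, a⁻¹], by simp [Matrix.det_fin_two_of, h0]⟩, ?_, by simp, by simp⟩
    refine mem_integralSubgroup.mpr ?_
    simp [Fin.forall_fin_two, h, hc]
  · have h0 : c ≠ 0 := norm_ne_zero_iff.mp (by simp [h])
    refine ⟨⟨!![a, -c⁻¹; c, 0], by simp [Matrix.det_fin_two_of, h0]⟩, ?_, by simp, by simp⟩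
    refine mem_integralSubgroup.mpr ?_
    simp [Fin.forall_fin_two, h, ha]

theorem mem_sl2USet_of_first_column {u : SL(2, ℚ_[p])} (h₀ : u 0 0 = 1) (h₁ : u 1 0 = 0) :
    u ∈ sl2USet p := by
  have hdet := u.det_coe
  rw [Matrix.det_fin_two, h₀, h₁, mul_zero, sub_zero, one_mul] at hdet
  exact ⟨h₀, hdet, h₁⟩

theorem mul_apply_zero (g h : SL(2, ℚ_[p])) (i : Fin 2) :
    (g * h) i 0 = g i 0 * h 0 0 + g i 1 * h 1 0 := by
  simp [Matrix.mul_apply, Fin.sum_univ_two]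

theorem mul_diag_first_column (k : SL(2, ℚ_[p])) (n : ℕ) (i : Fin 2) :
    (k * sl2DiagElt p n) i 0 = k i 0 * (p : ℚ_[p]) ^ (-(n : ℤ)) := by
  rw [mul_apply_zero]
  simp [sl2DiagElt]

theorem inv_mul_first_column {g h : SL(2, ℚ_[p])} (h₀ : g 0 0 = h 0 0) (h₁ : g 1 0 = h 1 0) :
    (h⁻¹ * g) 0 0 = 1 ∧ (h⁻¹ * g) 1 0 = 0 := by
  have e := mul_apply_zero h⁻¹ h
  simp only [inv_mul_cancel] at e
  rw [mul_apply_zero, mul_apply_zero, h₀, h₁, ← e, ← e]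
  simp

theorem mem_iwasawa_cell_iff {g : SL(2, ℚ_[p])} {n : ℕ} :
    g ∈ sl2KSet p * {sl2DiagElt p n} * sl2USet p ↔ max ‖g 0 0‖ ‖g 1 0‖ = (p : ℝ) ^ n := by
  have hp : (p : ℚ_[p]) ≠ 0 := Nat.cast_ne_zero.mpr (Fact.out : p.Prime).ne_zero
  have hpR : (0 : ℝ) < p := Nat.cast_pos.mpr (Fact.out : p.Prime).pos
  rw [← coe_integralSubgroup]
  constructor
  · rintro ⟨_, ⟨k, hk, _, rfl, rfl⟩, u, ⟨h₀, -, h₁⟩, rfl⟩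
    have e : ∀ i, (k * sl2DiagElt p n * u) i 0 = k i 0 * (p : ℚ_[p]) ^ (-(n : ℤ)) := fun i => by
      rw [mul_apply_zero, h₀, h₁, mul_diag_first_column, mul_one, mul_zero, add_zero]
    change max ‖(k * sl2DiagElt p n * u) 0 0‖ ‖(k * sl2DiagElt p n * u) 1 0‖ = _
    rw [e, e, norm_mul, norm_mul, ← max_mul_of_nonneg _ _ (norm_nonneg _),
      max_norm_first_column_eq_one hk, one_mul, Padic.norm_p_zpow, neg_neg, zpow_natCast]
  · intro h
    obtain ⟨k, hk, h₀, h₁⟩ := exists_integral_first_column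
      (a := g 0 0 * (p : ℚ_[p]) ^ n) (c := g 1 0 * (p : ℚ_[p]) ^ n) (by
        rw [norm_mul, norm_mul, ← max_mul_of_nonneg _ _ (norm_nonneg _), h, Padic.norm_p_pow,
          _root_.zpow_neg, zpow_natCast, mul_inv_cancel₀ (pow_pos hpR n).ne'])
    have e := inv_mul_first_column (g := g) (h := k * sl2DiagElt p n)
      (by rw [mul_diag_first_column, h₀]; simp [hp])
      (by rw [mul_diag_first_column, h₁]; simp [hp])
    exact ⟨_, ⟨k, hk, _, rfl, rfl⟩, _, mem_sl2USet_of_first_column e.1 e.2,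
      mul_inv_cancel_left _ _⟩

/-- The coset `K * {lower x}`. -/
noncomputable def lowerCoset (x : ℚ_[p]) : Set SL(2, ℚ_[p]) := sl2KSet p * {lower x}

theorem lowerCoset_eq_iff {x y : ℚ_[p]} : lowerCoset x = lowerCoset y ↔ ‖y - x‖ ≤ 1 := by
  rw [lowerCoset, lowerCoset, mul_singleton_eq_iff, lower_mul_lower_inv,
    lower_mem_integralSubgroup]

theorem image_eq_lowerCoset_image (n : ℕ) :
    (fun g => sl2KSet p * ({g} : Set SL(2, ℚ_[p]))) ''
        ((sl2KSet p * sl2UminusSet p) ∩ (sl2KSet p * {sl2DiagElt p n} * sl2USet p)) =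
      lowerCoset '' {x : ℚ_[p] | max 1 ‖x‖ = (p : ℝ) ^ n} := by
  have hlower : ∀ x : ℚ_[p], lower x ∈ sl2KSet p * {sl2DiagElt p n} * sl2USet p ↔
      max 1 ‖x‖ = (p : ℝ) ^ n := fun x => by
    rw [mem_iwasawa_cell_iff]
    simp [coe_lower]
  ext s
  constructor
  · rintro ⟨_, ⟨⟨k, hk, v, hv, rfl⟩, hg⟩, rfl⟩
    obtain ⟨x, rfl⟩ := mem_sl2UminusSet.mp hv
    rw [← coe_integralSubgroup] at hk
    refine ⟨x, (hlower x).mp ?_, ?_⟩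
    · obtain ⟨_, ⟨k', hk', d, hd, rfl⟩, u, hu, e⟩ := hg
      rw [← coe_integralSubgroup] at hk' ⊢
      refine ⟨_, ⟨k⁻¹ * k', mul_mem (inv_mem hk) hk', d, hd, rfl⟩, u, hu, ?_⟩
      simp only at e ⊢
      rw [mul_assoc, mul_assoc, ← mul_assoc k', e, inv_mul_cancel_left]
    · refine (mul_singleton_eq_iff _ _).mpr ?_
      simpa using hk
  · rintro ⟨x, hx, rfl⟩
    refine ⟨lower x, ⟨⟨1, ?_, lower x, mem_sl2UminusSet.mpr ⟨x, rfl⟩, one_mul _⟩,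
      (hlower x).mpr hx⟩, rfl⟩
    rw [← coe_integralSubgroup]
    exact one_mem _

theorem norm_natCast_div_pow (m n : ℕ) :
    ‖(m : ℚ_[p]) / (p : ℚ_[p]) ^ n‖ = ‖(m : ℚ_[p])‖ * (p : ℝ) ^ n := by
  simp [div_eq_mul_inv]

theorem max_one_norm_natCast_div_pow {m n : ℕ} (h : (p ^ n).Coprime m) :
    max 1 ‖(m : ℚ_[p]) / (p : ℚ_[p]) ^ n‖ = (p : ℝ) ^ n := by
  have hp : 1 ≤ (p : ℝ) := by exact_mod_cast (Fact.out : p.Prime).one_le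
  rw [norm_natCast_div_pow]
  rcases Nat.eq_zero_or_pos n with rfl | hn
  · simpa using Padic.norm_int_le_one (p := p) m
  · rw [Padic.norm_natCast_eq_one_iff.mpr ((Nat.coprime_pow_left_iff hn _ _).mp h), one_mul,
      max_eq_right (one_le_pow₀ hp)]

theorem norm_le_one_of_mul_pow {x : ℚ_[p]} {n : ℕ}
    (h : ‖x * (p : ℚ_[p]) ^ n‖ ≤ (p : ℝ) ^ (-n : ℤ)) : ‖x‖ ≤ 1 := by
  have hp : (0 : ℝ) < p := Nat.cast_pos.mpr (Fact.out : p.Prime).pos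
  rw [norm_mul, Padic.norm_p_pow] at h
  exact (mul_le_iff_le_one_left (zpow_pos hp _)).mp h

theorem lowerCoset_image_eq (n : ℕ) :
    lowerCoset '' {x : ℚ_[p] | max 1 ‖x‖ = (p : ℝ) ^ n} =
      (fun m : ℕ => lowerCoset ((m : ℚ_[p]) / (p : ℚ_[p]) ^ n)) ''
        ({m ∈ Finset.range (p ^ n) | (p ^ n).Coprime m} : Finset ℕ) := by
  have hp : (p : ℚ_[p]) ≠ 0 := Nat.cast_ne_zero.mpr (Fact.out : p.Prime).ne_zero
  have hp1 : 1 < (p : ℝ) := by exact_mod_cast (Fact.out : p.Prime).one_lt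
  ext s
  constructor
  · rintro ⟨x, hx, rfl⟩
    have hx' : ‖x‖ ≤ (p : ℝ) ^ n := hx ▸ le_max_right _ _
    have hpn : (0 : ℝ) < (p : ℝ) ^ n := by positivity
    let z : ℤ_[p] := ⟨x * (p : ℚ_[p]) ^ n, by
      rw [norm_mul, Padic.norm_p_pow, _root_.zpow_neg, zpow_natCast]
      exact mul_inv_le_one_of_le₀ hx' hpn.le⟩
    have happr : ‖((z - (z.appr n : ℤ_[p]) : ℤ_[p]) : ℚ_[p])‖ ≤ (p : ℝ) ^ (-n : ℤ) :=
      (PadicInt.norm_le_pow_iff_mem_span_pow _ _).mpr (PadicInt.appr_spec n z)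
    have hclose : ‖x - (z.appr n : ℚ_[p]) / (p : ℚ_[p]) ^ n‖ ≤ 1 := by
      refine norm_le_one_of_mul_pow (n := n) ?_
      convert happr using 2
      push_cast
      rw [sub_mul, div_mul_cancel₀ _ (pow_ne_zero n hp)]
    refine ⟨z.appr n, ?_, lowerCoset_eq_iff.mpr hclose⟩
    simp only [Finset.coe_filter, Finset.mem_range, Set.mem_ofPred_eq]
    refine ⟨PadicInt.appr_lt z n, ?_⟩
    rcases Nat.eq_zero_or_pos n with rfl | hn
    · simp
    · refine Nat.Coprime.pow_left n (Padic.norm_natCast_eq_one_iff.mp ?_)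
      have h1 : 1 < (p : ℝ) ^ n := one_lt_pow₀ hp1 hn.ne'
      have hxn : ‖x‖ = (p : ℝ) ^ n := by
        rcases max_choice 1 ‖x‖ with h | h
        · exact absurd (h.symm.trans hx) h1.ne
        · exact h.symm.trans hx
      have hy := Padic.norm_eq_of_norm_sub_lt_right
        (z1 := (z.appr n : ℚ_[p]) / (p : ℚ_[p]) ^ n) (z2 := x) (by
          rw [norm_sub_rev, hxn]; exact hclose.trans_lt h1)
      rw [norm_natCast_div_pow, hxn] at hy
      exact (mul_eq_right₀ hpn.ne').mp hy
  · rintro ⟨m, hm, rfl⟩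
    exact ⟨_, max_one_norm_natCast_div_pow (Finset.mem_filter.mp hm).2, rfl⟩

theorem lowerCoset_injOn (n : ℕ) :
    Set.InjOn (fun m : ℕ => lowerCoset ((m : ℚ_[p]) / (p : ℚ_[p]) ^ n))
      ({m ∈ Finset.range (p ^ n) | (p ^ n).Coprime m} : Finset ℕ) := by
  have hpR : (0 : ℝ) < p := Nat.cast_pos.mpr (Fact.out : p.Prime).pos
  intro a ha b hb hab
  have ha' := Finset.mem_range.mp (Finset.mem_filter.mp ha).1
  have hb' := Finset.mem_range.mp (Finset.mem_filter.mp hb).1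
  have h := lowerCoset_eq_iff.mp hab
  have hcast : (b : ℚ_[p]) - a = (((b : ℤ) - a : ℤ) : ℚ_[p]) := by push_cast; rfl
  rw [← sub_div, norm_div, Padic.norm_p_pow, div_le_one (zpow_pos hpR _), hcast,
    Padic.norm_int_le_pow_iff_dvd] at h
  have hmod : a ≡ b [MOD p ^ n] := (Nat.modEq_iff_dvd).mpr (by exact_mod_cast h)
  exact hmod.eq_of_lt_of_lt ha' hb'

end SL2Padic

/-- The rank-one (`SL₂`) computation of the coefficients of the
Gindikin–Karpelevich sum `c_𝔤` of formula (1.1) of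
Braverman–Garland–Kazhdan–Patnaik, "An affine Gindikin-Karpelevich formula":
the image of `K·U⁻ ∩ K·d_n·U` in `K\SL₂(ℚ_p)` (cosets `K·g` realized as the
subsets `K * {g}`) is finite, of cardinality `p^n - p^(n-1)` for `n ≥ 1` and
of cardinality `1` for `n = 0`. -/
theorem gk_coefficients_SL2
    (p : ℕ) [Fact p.Prime] (n : ℕ) :
    ((fun g => sl2KSet p * ({g} : Set (Matrix.SpecialLinearGroup (Fin 2) ℚ_[p]))) ''
        ((sl2KSet p * sl2UminusSet p) ∩
          (sl2KSet p * {sl2DiagElt p n} * sl2USet p))).Finite ∧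
      ((fun g => sl2KSet p * ({g} : Set (Matrix.SpecialLinearGroup (Fin 2) ℚ_[p]))) ''
        ((sl2KSet p * sl2UminusSet p) ∩
          (sl2KSet p * {sl2DiagElt p n} * sl2USet p))).ncard =
        if n = 0 then 1 else p ^ n - p ^ (n - 1) := by
  rw [SL2Padic.image_eq_lowerCoset_image, SL2Padic.lowerCoset_image_eq]
  refine ⟨(Finset.finite_toSet _).image _, ?_⟩
  rw [(SL2Padic.lowerCoset_injOn n).ncard_image, Set.ncard_coe_finset]
  change Nat.totient (p ^ n) = _
  split_ifs with hn
  · simp [hn]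
  · obtain ⟨m, rfl⟩ := Nat.exists_eq_succ_of_ne_zero hn
    rw [Nat.totient_prime_pow_succ Fact.out, Nat.mul_sub_one, Nat.succ_sub_one, pow_succ]
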